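/- arXiv:2209.07558 — 8 statements merged into one kernel-verified Lean document; each statement's English description precedes it below -/
import Mathlib

section
/- Let (J,R,Q,G,F,S,N) be pH plant data of state dimension n and port dimension m, and (J_K,R_K,Q_K,G_K,F_K,S_K,N_K) be pH controller data of state dimension k and port dimension m, and assume the well-posedness matrix Z₀ = [[I_m, S_K−N_K],[−(S−N), I_m]] is invertible. Then every eigenvalue λ ∈ ℂ of the negative-feedback closed-loop matrix A_cl (regarded as a complex matrix) satisfies Re(λ) ≤ 0. -/
open Matrix

/-- A skew-symmetric real matrix has vanishing quadratic form. -/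
theorem dotProduct_mulVec_self_of_transpose_eq_neg {ι : Type*} [Fintype ι] {A : Matrix ι ι ℝ}
    (hA : Aᵀ = -A) (z : ι → ℝ) : z ⬝ᵥ A *ᵥ z = 0 := by
  have h : z ⬝ᵥ A *ᵥ z = z ⬝ᵥ Aᵀ *ᵥ z := by
    rw [dotProduct_mulVec, mulVec_transpose, dotProduct_comm]
  rw [hA, neg_mulVec, dotProduct_neg] at h
  linarith

/-- Power balance of a port-Hamiltonian system: the stored energy grows at most at the rate
supplied through the port. Here `z = Q x` is the co-energy variable and `u` the input. -/
theorem portHamiltonian_power_le {ι κ : Type*} [Fintype ι] [Fintype κ]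
    {J R : Matrix ι ι ℝ} {G F : Matrix ι κ ℝ} {S N : Matrix κ κ ℝ}
    (hJ : Jᵀ = -J) (hN : Nᵀ = -N) (hW : (fromBlocks R F Fᵀ S).PosSemidef)
    (z : ι → ℝ) (u : κ → ℝ) :
    z ⬝ᵥ ((J - R) *ᵥ z + (G - F) *ᵥ u) ≤ u ⬝ᵥ ((G + F)ᵀ *ᵥ z + (S - N) *ᵥ u) := by
  have h := hW.dotProduct_mulVec_nonneg (Sum.elim z u)
  rw [star_trivial, fromBlocks_mulVec, sumElim_dotProduct_sumElim] at h
  have hT (B : Matrix ι κ ℝ) : u ⬝ᵥ Bᵀ *ᵥ z = z ⬝ᵥ B *ᵥ u := by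
    rw [dotProduct_mulVec, vecMul_transpose, dotProduct_comm]
  simp only [Sum.elim_comp_inl, Sum.elim_comp_inr, dotProduct_add, hT] at h
  simp only [transpose_add, add_mulVec, sub_mulVec, dotProduct_add, dotProduct_sub, hT,
    dotProduct_mulVec_self_of_transpose_eq_neg hJ, dotProduct_mulVec_self_of_transpose_eq_neg hN]
  linarith

/-- Block-diagonal matrices with positive definite blocks are positive definite. -/
theorem Matrix.PosDef.fromBlocks_zero {ι κ : Type*} [Fintype ι] [Fintype κ]
    {P : Matrix ι ι ℝ} {Q : Matrix κ κ ℝ} (hP : P.PosDef) (hQ : Q.PosDef) :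
    (fromBlocks P 0 0 Q).PosDef := by
  refine .of_dotProduct_mulVec_pos
    (IsHermitian.fromBlocks hP.isHermitian (by simp) hQ.isHermitian) fun x hx => ?_
  obtain ⟨a, b, rfl⟩ : ∃ a b, x = Sum.elim a b := ⟨_, _, (Sum.elim_comp_inl_inr x).symm⟩
  rw [star_trivial, fromBlocks_mulVec, sumElim_dotProduct_sumElim]
  simp only [Sum.elim_comp_inl, Sum.elim_comp_inr, zero_mulVec, add_zero, zero_add]
  have hPa := hP.posSemidef.dotProduct_mulVec_nonneg a
  have hQb := hQ.posSemidef.dotProduct_mulVec_nonneg b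
  rw [star_trivial] at hPa hQb
  by_cases ha : a = 0
  · have hb : b ≠ 0 := by
      rintro rfl
      exact hx (by rw [ha]; exact Sum.elim_zero_zero)
    have := hQ.dotProduct_mulVec_pos hb
    rw [star_trivial] at this
    linarith
  · have := hP.dotProduct_mulVec_pos ha
    rw [star_trivial] at this
    linarith

/-- If the quadratic form of a positive definite `P` is nonincreasing along `x' = A x`, then every
complex eigenvalue of `A` has nonpositive real part. -/
theorem Matrix.PosDef.eigenvalue_re_nonpos {ι : Type*} [Fintype ι] {P A : Matrix ι ι ℝ}
    (hP : P.PosDef) (hA : ∀ x : ι → ℝ, P *ᵥ x ⬝ᵥ A *ᵥ x ≤ 0)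
    {μ : ℂ} {v : ι → ℂ} (hv : v ≠ 0) (h : A.map Complex.ofReal *ᵥ v = μ • v) : μ.re ≤ 0 := by
  set a : ι → ℝ := fun i => (v i).re with ha
  set b : ι → ℝ := fun i => (v i).im with hb
  have hAa : A *ᵥ a = μ.re • a - μ.im • b := by
    ext i
    simpa [mulVec, dotProduct, ha, hb] using congrArg Complex.re (congrFun h i)
  have hAb : A *ᵥ b = μ.re • b + μ.im • a := by
    ext i
    simpa [mulVec, dotProduct, ha, hb] using congrArg Complex.im (congrFun h i)
  have hsymm : P *ᵥ a ⬝ᵥ b = P *ᵥ b ⬝ᵥ a := by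
    have hPT : Pᵀ = P := by simpa using hP.isHermitian.eq
    rw [dotProduct_comm, dotProduct_mulVec, ← mulVec_transpose, hPT]
  have h1 := hA a
  have h2 := hA b
  rw [hAa, dotProduct_sub, dotProduct_smul, dotProduct_smul, smul_eq_mul, smul_eq_mul] at h1
  rw [hAb, dotProduct_add, dotProduct_smul, dotProduct_smul, smul_eq_mul, smul_eq_mul] at h2
  have hpos : 0 < P *ᵥ a ⬝ᵥ a + P *ᵥ b ⬝ᵥ b := by
    have hnonneg (x : ι → ℝ) : 0 ≤ P *ᵥ x ⬝ᵥ x := by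
      simpa [dotProduct_comm] using hP.posSemidef.dotProduct_mulVec_nonneg x
    have hpos' {x : ι → ℝ} (hx : x ≠ 0) : 0 < P *ᵥ x ⬝ᵥ x := by
      simpa [dotProduct_comm] using hP.dotProduct_mulVec_pos hx
    by_cases ha0 : a = 0
    · have hb0 : b ≠ 0 := fun hb0 =>
        hv (funext fun i => Complex.ext (congrFun ha0 i) (congrFun hb0 i))
      exact add_pos_of_nonneg_of_pos (hnonneg a) (hpos' hb0)
    · exact add_pos_of_pos_of_nonneg (hpos' ha0) (hnonneg b)
  rw [hsymm] at h1
  by_contra! hμ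
  linarith [mul_pos hμ hpos]

/-- For pH plant data `(J,R,Q,G,F,S,N)` (state dim `n`, port dim `m`) and
pH controller data `(JK,RK,QK,GK,FK,SK,NK)` (state dim `k`, port dim `m`), with the
well-posedness matrix `Z₀ = [[I, SK−NK],[−(S−N), I]]` invertible, every eigenvalue of the
negative-feedback closed-loop matrix `A_cl` (as a complex matrix) has nonpositive real part. -/
theorem closed_loop_spectrum_in_closed_left_half_plane
    (n k m : ℕ)
    (J R Q : Matrix (Fin n) (Fin n) ℝ) (G F : Matrix (Fin n) (Fin m) ℝ)
    (S N : Matrix (Fin m) (Fin m) ℝ)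
    (JK RK QK : Matrix (Fin k) (Fin k) ℝ) (GK FK : Matrix (Fin k) (Fin m) ℝ)
    (SK NK : Matrix (Fin m) (Fin m) ℝ)
    (hJ : Jᵀ = -J) (hN : Nᵀ = -N) (hQ : Q.PosDef)
    (hW : (Matrix.fromBlocks R F Fᵀ S).PosSemidef)
    (hJK : JKᵀ = -JK) (hNK : NKᵀ = -NK) (hQK : QK.PosDef)
    (hWK : (Matrix.fromBlocks RK FK FKᵀ SK).PosSemidef)
    (Z0 : Matrix (Fin m ⊕ Fin m) (Fin m ⊕ Fin m) ℝ)
    (hZ0 : Z0 = Matrix.fromBlocks 1 (SK - NK) (-(S - N)) 1)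
    (hZ0inv : IsUnit Z0.det)
    (Acl : Matrix (Fin n ⊕ Fin k) (Fin n ⊕ Fin k) ℝ)
    (hAcl : Acl =
      Matrix.fromBlocks ((J - R) * Q) 0 0 ((JK - RK) * QK)
      + Matrix.fromBlocks (G - F) 0 0 (-(GK - FK)) * Z0⁻¹
        * Matrix.fromBlocks 0 ((GK + FK)ᵀ * QK) ((G + F)ᵀ * Q) 0) :
    ∀ (lam : ℂ) (v : Fin n ⊕ Fin k → ℂ), v ≠ 0 →
      (Acl.map (Complex.ofReal)).mulVec v = lam • v → lam.re ≤ 0 := by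
  intro lam v hv h
  refine (hQ.fromBlocks_zero hQK).eigenvalue_re_nonpos (fun x => ?_) hv h
  obtain ⟨p, q, rfl⟩ : ∃ p q, x = Sum.elim p q := ⟨_, _, (Sum.elim_comp_inl_inr x).symm⟩
  -- `a` is the plant input and `-b` the controller input
  obtain ⟨a, b, hab⟩ : ∃ a b, Z0⁻¹ *ᵥ (fromBlocks 0 ((GK + FK)ᵀ * QK) ((G + F)ᵀ * Q) 0 *ᵥ
      Sum.elim p q) = Sum.elim a b := ⟨_, _, (Sum.elim_comp_inl_inr _).symm⟩
  have hZ := congrArg (Z0 *ᵥ ·) hab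
  simp only [mulVec_mulVec, ← Matrix.mul_assoc, mul_nonsing_inv _ hZ0inv, Matrix.one_mul] at hZ
  rw [hZ0] at hZ
  simp only [fromBlocks_mulVec, Sum.elim_comp_inl, Sum.elim_comp_inr, zero_mulVec, one_mulVec,
    zero_add, add_zero, ← mulVec_mulVec, Sum.elim_eq_iff] at hZ
  obtain ⟨hZ1, hZ2⟩ := hZ
  have hplant := portHamiltonian_power_le (G := G) hJ hN hW (Q *ᵥ p) a
  have hctrl := portHamiltonian_power_le (G := GK) hJK hNK hWK (QK *ᵥ q) (-b)
  rw [hZ2] at hplant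
  rw [hZ1] at hctrl
  rw [hAcl, add_mulVec, ← mulVec_mulVec, ← mulVec_mulVec, hab]
  simp only [fromBlocks_mulVec, Sum.elim_comp_inl, Sum.elim_comp_inr, zero_mulVec,
    zero_add, add_zero, ← mulVec_mulVec, dotProduct_add, sumElim_dotProduct_sumElim]
  simp only [dotProduct_add, neg_mulVec, mulVec_neg, dotProduct_neg, neg_dotProduct,
    sub_mulVec, dotProduct_sub, dotProduct_comm b a] at hplant hctrl ⊢
  linarith
end

section
/- Let (J,R,Q,G,F,S,N) be pH plant data of state dimension n and port dimension m, and (J_K,R_K,Q_K,G_K,F_K,S_K,N_K) be pH controller data of state dimension k and port dimension m, and assume the well-posedness matrix Z₀ = [[I_m, S_K−N_K],[−(S−N), I_m]] is invertible. If λ ∈ ℂ is purely imaginary (Re(λ) = 0), then λ is a semisimple eigenvalue of the negative-feedback closed-loop matrix A_cl regarded as a complex matrix, i.e., ker((A_cl − λI)²) = ker(A_cl − λI) over ℂ^{n+k}. -/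
open Matrix
open scoped ComplexOrder

/-- The quadratic form of a real symmetric matrix at a complex vector is the sum of its values at
the real and imaginary parts. -/
theorem star_dotProduct_map_ofReal_mulVec {ι : Type*} [Fintype ι] {P : Matrix ι ι ℝ}
    (hP : P.IsHermitian) (x : ι → ℂ) :
    star x ⬝ᵥ (P.map Complex.ofReal *ᵥ x) =
      (((fun i => (x i).re) ⬝ᵥ (P *ᵥ fun i => (x i).re) +
        (fun i => (x i).im) ⬝ᵥ (P *ᵥ fun i => (x i).im) : ℝ) : ℂ) := by
  have hsymm : (fun i => (x i).re) ⬝ᵥ (P *ᵥ fun i => (x i).im) =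
      (fun i => (x i).im) ⬝ᵥ (P *ᵥ fun i => (x i).re) := by
    have hPt : Pᵀ = P := hP
    rw [dotProduct_mulVec, ← mulVec_transpose, hPt, dotProduct_comm]
  have hre : ∀ i, ((P.map Complex.ofReal *ᵥ x) i).re = (P *ᵥ fun i => (x i).re) i := by
    simp [mulVec, dotProduct]
  have him : ∀ i, ((P.map Complex.ofReal *ᵥ x) i).im = (P *ᵥ fun i => (x i).im) i := by
    simp [mulVec, dotProduct]
  apply Complex.ext
  · simp [dotProduct, hre, him, Finset.sum_add_distrib]
  · simp only [dotProduct] at hsymm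
    simp [dotProduct, hre, him, Finset.sum_add_distrib, hsymm]

theorem isHermitian_map_ofReal {ι : Type*} {P : Matrix ι ι ℝ} (hP : P.IsHermitian) :
    (P.map Complex.ofReal).IsHermitian :=
  hP.map _ fun r => (Complex.conj_ofReal r).symm

theorem posSemidef_map_ofReal {ι : Type*} [Fintype ι] {P : Matrix ι ι ℝ} (hP : P.PosSemidef) :
    (P.map Complex.ofReal).PosSemidef := by
  refine .of_dotProduct_mulVec_nonneg (isHermitian_map_ofReal hP.isHermitian) fun x => ?_
  rw [star_dotProduct_map_ofReal_mulVec hP.isHermitian, Complex.zero_le_real]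
  exact add_nonneg (by simpa using hP.dotProduct_mulVec_nonneg fun i => (x i).re)
    (by simpa using hP.dotProduct_mulVec_nonneg fun i => (x i).im)

theorem posDef_map_ofReal {ι : Type*} [Fintype ι] {P : Matrix ι ι ℝ}
    (hP : P.PosDef) : (P.map Complex.ofReal).PosDef := by
  refine .of_dotProduct_mulVec_pos (isHermitian_map_ofReal hP.isHermitian) fun x hx => ?_
  have hnonneg (y : ι → ℝ) : 0 ≤ y ⬝ᵥ (P *ᵥ y) := by
    simpa using hP.posSemidef.dotProduct_mulVec_nonneg y
  have hpos {y : ι → ℝ} (hy : y ≠ 0) : 0 < y ⬝ᵥ (P *ᵥ y) := by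
    simpa using hP.dotProduct_mulVec_pos hy
  rw [star_dotProduct_map_ofReal_mulVec hP.isHermitian, Complex.zero_lt_real]
  by_cases hre : (fun i => (x i).re) = 0
  · have him : (fun i => (x i).im) ≠ 0 := fun him =>
      hx (funext fun i => Complex.ext (congrFun hre i) (congrFun him i))
    exact add_pos_of_nonneg_of_pos (hnonneg _) (hpos him)
  · exact add_pos_of_pos_of_nonneg (hpos hre) (hnonneg _)

theorem posDef_fromBlocks_zero {ι κ : Type*} [Fintype ι] [Fintype κ] {P : Matrix ι ι ℝ}
    {L : Matrix κ κ ℝ} (hP : P.PosDef) (hL : L.PosDef) : (fromBlocks P 0 0 L).PosDef := by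
  refine .of_dotProduct_mulVec_pos
    (hP.isHermitian.fromBlocks (by simp) hL.isHermitian) fun x hx => ?_
  rw [← Sum.elim_comp_inl_inr x] at hx ⊢
  generalize x ∘ Sum.inl = y at hx ⊢
  generalize x ∘ Sum.inr = z at hx ⊢
  have hz : 0 ≤ z ⬝ᵥ (L *ᵥ z) := by simpa using hL.posSemidef.dotProduct_mulVec_nonneg z
  have hy : 0 ≤ y ⬝ᵥ (P *ᵥ y) := by simpa using hP.posSemidef.dotProduct_mulVec_nonneg y
  simp only [star_trivial, fromBlocks_mulVec, Sum.elim_comp_inl, Sum.elim_comp_inr, zero_mulVec,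
    add_zero, zero_add, sumElim_dotProduct_sumElim]
  by_cases hy0 : y = 0
  · have hz0 : z ≠ 0 := by
      rintro rfl
      exact hx (by simp [hy0])
    exact add_pos_of_nonneg_of_pos hy (by simpa using hL.dotProduct_mulVec_pos hz0)
  · exact add_pos_of_pos_of_nonneg (by simpa using hP.dotProduct_mulVec_pos hy0) hz

/-- If the Lyapunov matrix `HM + MᴴH` of a positive definite `H` is negative semidefinite, then
`0` is a semisimple eigenvalue of `M`. -/
theorem mulVec_eq_zero_of_mul_self_mulVec_eq_zero {ι : Type*} [Fintype ι]
    {H M : Matrix ι ι ℂ} (hH : H.PosDef) (hM : (-(H * M + Mᴴ * H)).PosSemidef)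
    {v : ι → ℂ} (hv : (M * M) *ᵥ v = 0) : M *ᵥ v = 0 := by
  set w := M *ᵥ v with hw
  have hMw : M *ᵥ w = 0 := by rw [hw, mulVec_mulVec, hv]
  have hLw : (-(H * M + Mᴴ * H)) *ᵥ w = -(Mᴴ *ᵥ (H *ᵥ w)) := by
    rw [neg_mulVec, add_mulVec, ← mulVec_mulVec, ← mulVec_mulVec, hMw, mulVec_zero, zero_add]
  have hadj (u : ι → ℂ) : star u ⬝ᵥ (Mᴴ *ᵥ (H *ᵥ w)) = star (M *ᵥ u) ⬝ᵥ (H *ᵥ w) := by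
    rw [dotProduct_mulVec, star_mulVec]
  have hzero : Mᴴ *ᵥ (H *ᵥ w) = 0 := by
    rw [← neg_eq_zero, ← hLw, ← hM.dotProduct_mulVec_zero_iff, hLw, dotProduct_neg, hadj, hMw]
    simp
  by_contra hne
  have hpos := hH.dotProduct_mulVec_pos hne
  rw [hw, ← hadj, hzero, dotProduct_zero] at hpos
  exact lt_irrefl _ hpos

theorem dotProduct_mulVec_self_eq_zero_of_transpose_eq_neg {ι : Type*} [Fintype ι]
    {J : Matrix ι ι ℝ} (hJ : Jᵀ = -J) (x : ι → ℝ) : x ⬝ᵥ (J *ᵥ x) = 0 := by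
  have h : x ⬝ᵥ (J *ᵥ x) = -(x ⬝ᵥ (J *ᵥ x)) := by
    conv_lhs => rw [dotProduct_mulVec, ← mulVec_transpose, hJ, neg_mulVec, neg_dotProduct,
      dotProduct_comm]
  linarith

/-- Dissipation inequality: the power stored in a port-Hamiltonian system with effort `e` and
input `u` is at most the power supplied through the port. -/
theorem portHamiltonian_dissipation {ι μ : Type*} [Fintype ι] [Fintype μ]
    {J R : Matrix ι ι ℝ} {G F : Matrix ι μ ℝ} {S N : Matrix μ μ ℝ}
    (hJ : Jᵀ = -J) (hN : Nᵀ = -N) (hW : (fromBlocks R F Fᵀ S).PosSemidef)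
    (e : ι → ℝ) (u : μ → ℝ) :
    e ⬝ᵥ ((J - R) *ᵥ e + (G - F) *ᵥ u) ≤ u ⬝ᵥ ((G + F)ᵀ *ᵥ e + (S - N) *ᵥ u) := by
  have hpsd := hW.dotProduct_mulVec_nonneg (Sum.elim e u)
  have hskewJ := dotProduct_mulVec_self_eq_zero_of_transpose_eq_neg hJ e
  have hskewN := dotProduct_mulVec_self_eq_zero_of_transpose_eq_neg hN u
  have hadj (B : Matrix ι μ ℝ) : u ⬝ᵥ (Bᵀ *ᵥ e) = e ⬝ᵥ (B *ᵥ u) := by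
    rw [mulVec_transpose, dotProduct_comm, ← dotProduct_mulVec]
  simp only [star_trivial, fromBlocks_mulVec, Sum.elim_comp_inl, Sum.elim_comp_inr,
    sumElim_dotProduct_sumElim, dotProduct_add, hadj] at hpsd
  simp only [dotProduct_add, hadj, sub_mulVec, add_mulVec, dotProduct_sub]
  linarith

/-- A real matrix with `xᵀHAx ≤ 0` for all `x` has negative semidefinite Lyapunov matrix. -/
theorem posSemidef_neg_lyapunov {ι : Type*} [Fintype ι] {H A : Matrix ι ι ℝ}
    (hH : H.IsHermitian) (hA : ∀ x, (H *ᵥ x) ⬝ᵥ (A *ᵥ x) ≤ 0) :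
    (-(H * A + Aᵀ * H)).PosSemidef := by
  have hHt : Hᵀ = H := hH
  refine .of_dotProduct_mulVec_nonneg ?_ fun x => ?_
  · rw [IsHermitian, conjTranspose_eq_transpose_of_trivial]
    simp [hHt, add_comm]
  · have hleft : x ⬝ᵥ (H *ᵥ (A *ᵥ x)) = (H *ᵥ x) ⬝ᵥ (A *ᵥ x) := by
      rw [dotProduct_mulVec, ← mulVec_transpose, hHt]
    have hright : x ⬝ᵥ (Aᵀ *ᵥ (H *ᵥ x)) = (H *ᵥ x) ⬝ᵥ (A *ᵥ x) := by
      rw [mulVec_transpose, dotProduct_comm, ← dotProduct_mulVec]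
    have := hA x
    rw [star_trivial, neg_mulVec, dotProduct_neg, add_mulVec, dotProduct_add, ← mulVec_mulVec,
      ← mulVec_mulVec, hleft, hright]
    linarith

/-- The closed-loop Hamiltonian is nonincreasing: the port powers of the plant (input `u`,
output `w`) and of the controller (input `-w`, output `u`) cancel. -/
theorem closedLoop_dissipation {ι κ μ : Type*} [Fintype ι] [Fintype κ] [Fintype μ] [DecidableEq μ]
    {J R Q : Matrix ι ι ℝ} {G F : Matrix ι μ ℝ} {S N : Matrix μ μ ℝ}
    {JK RK QK : Matrix κ κ ℝ} {GK FK : Matrix κ μ ℝ} {SK NK : Matrix μ μ ℝ}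
    (hJ : Jᵀ = -J) (hN : Nᵀ = -N) (hW : (fromBlocks R F Fᵀ S).PosSemidef)
    (hJK : JKᵀ = -JK) (hNK : NKᵀ = -NK) (hWK : (fromBlocks RK FK FKᵀ SK).PosSemidef)
    (hZ : IsUnit (fromBlocks 1 (SK - NK) (-(S - N)) 1).det) (x : ι ⊕ κ → ℝ) :
    (fromBlocks Q 0 0 QK *ᵥ x) ⬝ᵥ
      ((fromBlocks ((J - R) * Q) 0 0 ((JK - RK) * QK)
        + fromBlocks (G - F) 0 0 (-(GK - FK)) * (fromBlocks 1 (SK - NK) (-(S - N)) 1)⁻¹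
          * fromBlocks 0 ((GK + FK)ᵀ * QK) ((G + F)ᵀ * Q) 0) *ᵥ x) ≤ 0 := by
  set Z := fromBlocks 1 (SK - NK) (-(S - N)) 1
  set C := fromBlocks 0 ((GK + FK)ᵀ * QK) ((G + F)ᵀ * Q) 0 with hC
  set z := Z⁻¹ *ᵥ (C *ᵥ x) with hz
  have hZz : Z *ᵥ z = C *ᵥ x := by
    rw [hz, mulVec_mulVec, mul_nonsing_inv _ hZ, one_mulVec]
  rw [add_mulVec, ← mulVec_mulVec, ← mulVec_mulVec, ← hz]
  simp only [Z, hC, fromBlocks_mulVec, one_mulVec, zero_mulVec, zero_add, add_zero, neg_mulVec,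
    Sum.elim_eq_iff, ← mulVec_mulVec] at hZz
  obtain ⟨hu, hw⟩ := hZz
  simp only [fromBlocks_mulVec, zero_mulVec, zero_add, add_zero, ← mulVec_mulVec,
    ← Sum.elim_add_add, sumElim_dotProduct_sumElim]
  have hplant := portHamiltonian_dissipation (G := G) hJ hN hW (Q *ᵥ (x ∘ Sum.inl)) (z ∘ Sum.inl)
  have hctrl := portHamiltonian_dissipation (G := GK) hJK hNK hWK
    (QK *ᵥ (x ∘ Sum.inr)) (-(z ∘ Sum.inr))
  rw [← hw, neg_add_cancel_comm] at hplant
  rw [← hu, mulVec_neg, mulVec_neg, add_neg_cancel_right, neg_dotProduct,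
    dotProduct_comm (z ∘ Sum.inr)]
    at hctrl
  rw [neg_mulVec]
  linarith

/-- With pH plant and pH controller data and a well-posed negative-feedback
interconnection, every purely imaginary eigenvalue of the closed-loop matrix `A_cl` is
semisimple: `ker((A_cl − λI)²) = ker(A_cl − λI)` over `ℂ^{n+k}`. -/
theorem closed_loop_imaginary_eigenvalues_semisimple
    (n k m : ℕ)
    (J R Q : Matrix (Fin n) (Fin n) ℝ) (G F : Matrix (Fin n) (Fin m) ℝ)
    (S N : Matrix (Fin m) (Fin m) ℝ)
    (JK RK QK : Matrix (Fin k) (Fin k) ℝ) (GK FK : Matrix (Fin k) (Fin m) ℝ)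
    (SK NK : Matrix (Fin m) (Fin m) ℝ)
    (hJ : Jᵀ = -J) (hN : Nᵀ = -N) (hQ : Q.PosDef)
    (hW : (Matrix.fromBlocks R F Fᵀ S).PosSemidef)
    (hJK : JKᵀ = -JK) (hNK : NKᵀ = -NK) (hQK : QK.PosDef)
    (hWK : (Matrix.fromBlocks RK FK FKᵀ SK).PosSemidef)
    (Z0 : Matrix (Fin m ⊕ Fin m) (Fin m ⊕ Fin m) ℝ)
    (hZ0 : Z0 = Matrix.fromBlocks 1 (SK - NK) (-(S - N)) 1)
    (hZ0inv : IsUnit Z0.det)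
    (Acl : Matrix (Fin n ⊕ Fin k) (Fin n ⊕ Fin k) ℝ)
    (hAcl : Acl =
      Matrix.fromBlocks ((J - R) * Q) 0 0 ((JK - RK) * QK)
      + Matrix.fromBlocks (G - F) 0 0 (-(GK - FK)) * Z0⁻¹
        * Matrix.fromBlocks 0 ((GK + FK)ᵀ * QK) ((G + F)ᵀ * Q) 0) :
    ∀ (lam : ℂ), lam.re = 0 →
      ∀ v : Fin n ⊕ Fin k → ℂ,
        ((Acl.map (Complex.ofReal) - lam • 1) *
          (Acl.map (Complex.ofReal) - lam • 1)).mulVec v = 0 ↔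
        (Acl.map (Complex.ofReal) - lam • 1).mulVec v = 0 := by
  intro lam hlam v
  refine ⟨fun hv => ?_, fun hv => by rw [← mulVec_mulVec, hv, mulVec_zero]⟩
  have hH := posDef_fromBlocks_zero hQ hQK
  set H := fromBlocks Q 0 0 QK
  have hL : (-(H * Acl + Aclᵀ * H)).PosSemidef := by
    refine posSemidef_neg_lyapunov hH.isHermitian fun x => ?_
    subst hZ0
    rw [hAcl]
    exact closedLoop_dissipation hJ hN hW hJK hNK hWK hZ0inv x
  refine mulVec_eq_zero_of_mul_self_mulVec_eq_zero (posDef_map_ofReal hH) ?_ hv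
  convert posSemidef_map_ofReal hL using 1
  have hstar : star lam = -lam := Complex.ext (by simp [hlam]) (by simp)
  have hconj : (Acl.map Complex.ofReal)ᴴ = Aclᵀ.map Complex.ofReal := by
    ext i j
    simp
  have hmap : (-(H * Acl + Aclᵀ * H)).map Complex.ofReal =
      -(H.map Complex.ofReal * Acl.map Complex.ofReal
        + Aclᵀ.map Complex.ofReal * H.map Complex.ofReal) := by
    ext i j
    simp [mul_apply]
  rw [hmap, conjTranspose_sub, conjTranspose_smul, conjTranspose_one, hconj, hstar, mul_sub,
    sub_mul, mul_smul_comm, smul_mul_assoc, mul_one, one_mul, neg_smul]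
  abel
end

section
/- Let (J,R,Q,G,F,S,N) be pH plant data of state dimension n and port dimension m, and (J_K,R_K,Q_K,G_K,F_K,S_K,N_K) be pH controller data of state dimension k and port dimension m. Assume the matrix Z = [[S−N, I_m],[−I_m, S_K−N_K]] is invertible (equivalently, the interconnection is well-posed). For s ∈ ℂ, let L(s) be the (n+k+2m)×(n+k+2m) block matrix L(s) = [[sI_n − (J−R)Q, 0, −G+F, 0],[0, sI_k − (J_K−R_K)Q_K, 0, −G_K+F_K],[(G+F)ᵀQ, 0, S−N, I_m],[0, (G_K+F_K)ᵀQ_K, −I_m, S_K−N_K]]. Then for all s ∈ ℂ, det L(s) = det(Z) · det(sI_{n+k} − A_cl), where A_cl is the negative-feedback closed-loop matrix. In particular, the finite eigenvalues of the pencil L(s) are exactly the eigenvalues of A_cl. -/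
open Matrix

/-- Swapping the block rows of the output map and of `[[a, 1], [-1, b]]`, and flipping the sign of
the first input, leaves the feedback term unchanged. -/
theorem feedback_term_eq {ι κ μ : Type*} [Fintype μ] [DecidableEq μ]
    {K : Type*} [CommRing K] (a b : Matrix μ μ K) (B₁ : Matrix ι μ K) (B₂ : Matrix κ μ K)
    (C₁ : Matrix μ ι K) (C₂ : Matrix μ κ K) :
    fromBlocks B₁ 0 0 (-B₂) * (fromBlocks 1 b (-a) 1)⁻¹ * fromBlocks 0 C₂ C₁ 0 =
      fromBlocks (-B₁) 0 0 (-B₂) * (fromBlocks a 1 (-1) b)⁻¹ * fromBlocks C₁ 0 0 C₂ := by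
  set P : Matrix (μ ⊕ μ) (μ ⊕ μ) K := fromBlocks 0 1 1 0 with hP
  set E : Matrix (μ ⊕ μ) (μ ⊕ μ) K := fromBlocks (-1) 0 0 1 with hE
  have hPP : P * P = 1 := by simp [hP, fromBlocks_multiply]
  have hEE : E * E = 1 := by simp [hE, fromBlocks_multiply]
  have hZ : fromBlocks 1 b (-a) 1 = P * fromBlocks a 1 (-1) b * E := by
    simp [hP, hE, fromBlocks_multiply]
  have hC : fromBlocks 0 C₂ C₁ 0 = P * fromBlocks C₁ 0 0 C₂ := by
    simp [hP, fromBlocks_multiply]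
  have hB : fromBlocks (-B₁) 0 0 (-B₂) = fromBlocks B₁ 0 0 (-B₂) * E := by
    simp [hE, fromBlocks_multiply]
  rw [hZ, hC, hB, Matrix.mul_inv_rev, Matrix.mul_inv_rev, inv_eq_left_inv hPP,
    inv_eq_left_inv hEE]
  simp only [Matrix.mul_assoc]
  rw [← Matrix.mul_assoc P P, hPP, Matrix.one_mul]

/-- For pH plant and controller data with `Z = [[S−N, I],[−I, SK−NK]]`
invertible, the determinant of the closed-loop pencil `L(s)` satisfies
`det L(s) = det(Z) · det(sI − A_cl)` for all `s ∈ ℂ`, where `A_cl` is the negative-feedback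
closed-loop matrix. -/
theorem pencil_det_eq_det_Z_mul_charpoly
    (n k m : ℕ)
    (J R Q : Matrix (Fin n) (Fin n) ℝ) (G F : Matrix (Fin n) (Fin m) ℝ)
    (S N : Matrix (Fin m) (Fin m) ℝ)
    (JK RK QK : Matrix (Fin k) (Fin k) ℝ) (GK FK : Matrix (Fin k) (Fin m) ℝ)
    (SK NK : Matrix (Fin m) (Fin m) ℝ)
    (hJ : Jᵀ = -J) (hN : Nᵀ = -N) (hQ : Q.PosDef)
    (hW : (Matrix.fromBlocks R F Fᵀ S).PosSemidef)
    (hJK : JKᵀ = -JK) (hNK : NKᵀ = -NK) (hQK : QK.PosDef)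
    (hWK : (Matrix.fromBlocks RK FK FKᵀ SK).PosSemidef)
    (Z : Matrix (Fin m ⊕ Fin m) (Fin m ⊕ Fin m) ℝ)
    (hZ : Z = Matrix.fromBlocks (S - N) 1 (-1) (SK - NK))
    (hZinv : IsUnit Z.det)
    (Z0 : Matrix (Fin m ⊕ Fin m) (Fin m ⊕ Fin m) ℝ)
    (hZ0 : Z0 = Matrix.fromBlocks 1 (SK - NK) (-(S - N)) 1)
    (Acl : Matrix (Fin n ⊕ Fin k) (Fin n ⊕ Fin k) ℝ)
    (hAcl : Acl =
      Matrix.fromBlocks ((J - R) * Q) 0 0 ((JK - RK) * QK)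
      + Matrix.fromBlocks (G - F) 0 0 (-(GK - FK)) * Z0⁻¹
        * Matrix.fromBlocks 0 ((GK + FK)ᵀ * QK) ((G + F)ᵀ * Q) 0)
    (L : ℂ → Matrix ((Fin n ⊕ Fin k) ⊕ (Fin m ⊕ Fin m))
                    ((Fin n ⊕ Fin k) ⊕ (Fin m ⊕ Fin m)) ℂ)
    (hL : ∀ s : ℂ, L s = Matrix.fromBlocks
      (Matrix.fromBlocks (s • 1 - ((J - R) * Q).map Complex.ofReal) 0
                         0 (s • 1 - ((JK - RK) * QK).map Complex.ofReal))
      (Matrix.fromBlocks ((-G + F).map Complex.ofReal) 0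
                         0 ((-GK + FK).map Complex.ofReal))
      (Matrix.fromBlocks (((G + F)ᵀ * Q).map Complex.ofReal) 0
                         0 (((GK + FK)ᵀ * QK).map Complex.ofReal))
      (Matrix.fromBlocks ((S - N).map Complex.ofReal) 1
                         (-1) ((SK - NK).map Complex.ofReal))) :
    ∀ s : ℂ, (L s).det = (Z.det : ℂ) * (s • 1 - Acl.map Complex.ofReal).det := by
  intro s
  let f : ℝ →+* ℂ := Complex.ofRealHom
  rw [hZ0, feedback_term_eq, ← hZ] at hAcl
  have hZdet : (Z.map f).det = (Z.det : ℂ) := (f.map_det Z).symm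
  have hZmul : Z.map f * Z⁻¹.map f = 1 := by
    rw [← Matrix.map_mul, Matrix.mul_nonsing_inv Z hZinv]
    exact Matrix.map_one f f.map_zero f.map_one
  let : Invertible (Z.map f) := invertibleOfRightInverse _ _ hZmul
  have hinv : ⅟(Z.map f) = Z⁻¹.map f := rfl
  have hblock : L s = fromBlocks
      (s • 1 - (fromBlocks ((J - R) * Q) 0 0 ((JK - RK) * QK)).map f)
      ((fromBlocks (-(G - F)) 0 0 (-(GK - FK))).map f)
      ((fromBlocks ((G + F)ᵀ * Q) 0 0 ((GK + FK)ᵀ * QK)).map f) (Z.map f) := by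
    rw [hL s, hZ]
    simp only [fromBlocks_map, ← fromBlocks_one, fromBlocks_smul, sub_eq_add_neg, fromBlocks_neg,
      fromBlocks_add]
    congr 2 <;> ext i j <;> simp [f, Matrix.one_apply, apply_ite] <;> ring
  have hAclmap : s • 1 - Acl.map Complex.ofReal =
      s • 1 - (fromBlocks ((J - R) * Q) 0 0 ((JK - RK) * QK)).map f -
        (fromBlocks (-(G - F)) 0 0 (-(GK - FK))).map f * Z⁻¹.map f *
          (fromBlocks ((G + F)ᵀ * Q) 0 0 ((GK + FK)ᵀ * QK)).map f := by
    change s • 1 - Acl.map f = _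
    rw [hAcl, Matrix.map_add f f.map_add, Matrix.map_mul, Matrix.map_mul, sub_sub]
  rw [hblock, det_fromBlocks₂₂, hinv, hZdet, hAclmap]
end

section
/- Let (J,R,Q,G,F,S,N) be pH system data of state dimension k and port dimension m, and set A = (J−R)Q, B = G−F, C = (G+F)ᵀQ, D = S−N. Then X = Q is a symmetric positive definite solution of the Kalman–Yakubovich–Popov inequality: the matrix [[−AᵀX − XA, Cᵀ − XB],[C − BᵀX, D + Dᵀ]] is symmetric positive semidefinite; indeed it equals 2·diag(Q, I_m)·W·diag(Q, I_m) where W = [[R, F],[Fᵀ, S]]. -/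
open Matrix

/-- For pH system data with `A = (J−R)Q`, `B = G−F`, `C = (G+F)ᵀQ`,
`D = S−N`, the matrix `X = Q` solves the KYP inequality: the KYP matrix
`[[−AᵀX−XA, Cᵀ−XB],[C−BᵀX, D+Dᵀ]]` is positive semidefinite, and indeed equals
`2·diag(Q,I)·W·diag(Q,I)` with `W = [[R,F],[Fᵀ,S]]`. -/
theorem pH_data_solves_KYP
    (k m : ℕ)
    (J R Q : Matrix (Fin k) (Fin k) ℝ) (G F : Matrix (Fin k) (Fin m) ℝ)
    (S N : Matrix (Fin m) (Fin m) ℝ)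
    (hJ : Jᵀ = -J) (hN : Nᵀ = -N) (hQ : Q.PosDef)
    (hW : (Matrix.fromBlocks R F Fᵀ S).PosSemidef)
    (A : Matrix (Fin k) (Fin k) ℝ) (B : Matrix (Fin k) (Fin m) ℝ)
    (C : Matrix (Fin m) (Fin k) ℝ) (D : Matrix (Fin m) (Fin m) ℝ)
    (hA : A = (J - R) * Q) (hB : B = G - F)
    (hC : C = (G + F)ᵀ * Q) (hD : D = S - N) :
    (Matrix.fromBlocks (-(Aᵀ * Q) - Q * A) (Cᵀ - Q * B)
                       (C - Bᵀ * Q) (D + Dᵀ)).PosSemidef ∧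
    Matrix.fromBlocks (-(Aᵀ * Q) - Q * A) (Cᵀ - Q * B) (C - Bᵀ * Q) (D + Dᵀ) =
      (2 : ℝ) • (Matrix.fromBlocks Q 0 0 1 * Matrix.fromBlocks R F Fᵀ S *
        Matrix.fromBlocks Q 0 0 1) := by
  have hQt : Qᵀ = Q := by simpa using hQ.isHermitian.eq
  obtain ⟨hR, hS⟩ : Rᵀ = R ∧ Sᵀ = S := by
    simpa [fromBlocks_transpose, fromBlocks_inj] using hW.isHermitian.eq
  have key : fromBlocks (-(Aᵀ * Q) - Q * A) (Cᵀ - Q * B) (C - Bᵀ * Q) (D + Dᵀ) =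
      (2 : ℝ) • (fromBlocks Q 0 0 1 * fromBlocks R F Fᵀ S * fromBlocks Q 0 0 1) := by
    subst hA hB hC hD
    simp only [fromBlocks_multiply, fromBlocks_add, transpose_mul, transpose_sub, transpose_add,
      transpose_transpose, hJ, hN, hQt, hR, hS, two_smul, Matrix.mul_zero,
      Matrix.zero_mul, add_zero, zero_add, Matrix.mul_one, Matrix.one_mul,
      Matrix.mul_sub, Matrix.add_mul, Matrix.sub_mul, Matrix.mul_neg, Matrix.neg_mul,
      Matrix.mul_assoc]
    congr 1 <;> abel
  refine ⟨?_, key⟩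
  have hdiag : (fromBlocks Q 0 0 (1 : Matrix (Fin m) (Fin m) ℝ))ᴴ = fromBlocks Q 0 0 1 := by
    simp [fromBlocks_transpose, hQt]
  rw [key]
  have hcongr := hW.conjTranspose_mul_mul_same
    (fromBlocks Q 0 0 (1 : Matrix (Fin m) (Fin m) ℝ))
  rw [hdiag] at hcongr
  exact hcongr.smul zero_le_two
end

section
/- Let A ∈ ℝ^{k×k}, B ∈ ℝ^{k×m}, C ∈ ℝ^{m×k}, D ∈ ℝ^{m×m}, and suppose there exists a symmetric positive definite X ∈ ℝ^{k×k} such that the KYP matrix [[−AᵀX − XA, Cᵀ − XB],[C − BᵀX, D + Dᵀ]] is positive semidefinite. Then the system can be written in port-Hamiltonian form: there exist real matrices J, R, Q ∈ ℝ^{k×k}, G, F ∈ ℝ^{k×m}, S, N ∈ ℝ^{m×m} with J and N skew-symmetric, Q symmetric positive definite, and [[R, F],[Fᵀ, S]] symmetric positive semidefinite, such that A = (J−R)Q, B = G−F, C = (G+F)ᵀQ, and D = S−N. -/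
open Matrix

/-- If `(A,B,C,D)` admits a symmetric positive definite KYP certificate `X`,
then the system can be written in port-Hamiltonian form: there exist `J, R, Q, G, F, S, N`
with `J, N` skew-symmetric, `Q ≻ 0`, `[[R,F],[Fᵀ,S]] ⪰ 0`, and `A = (J−R)Q`, `B = G−F`,
`C = (G+F)ᵀQ`, `D = S−N`. -/
theorem KYP_solution_gives_pH_form
    (k m : ℕ)
    (A : Matrix (Fin k) (Fin k) ℝ) (B : Matrix (Fin k) (Fin m) ℝ)
    (C : Matrix (Fin m) (Fin k) ℝ) (D : Matrix (Fin m) (Fin m) ℝ)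
    (X : Matrix (Fin k) (Fin k) ℝ) (hX : X.PosDef)
    (hKYP : (Matrix.fromBlocks (-(Aᵀ * X) - X * A) (Cᵀ - X * B)
                               (C - Bᵀ * X) (D + Dᵀ)).PosSemidef) :
    ∃ (J R Q : Matrix (Fin k) (Fin k) ℝ) (G F : Matrix (Fin k) (Fin m) ℝ)
      (S N : Matrix (Fin m) (Fin m) ℝ),
        Jᵀ = -J ∧ Nᵀ = -N ∧ Q.PosDef ∧
        (Matrix.fromBlocks R F Fᵀ S).PosSemidef ∧
        A = (J - R) * Q ∧ B = G - F ∧ C = (G + F)ᵀ * Q ∧ D = S - N := by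
  have hXt : Xᵀ = X := by simpa using hX.isHermitian.eq
  obtain ⟨Y, hXY, hYX, hYt⟩ : ∃ Y : Matrix (Fin k) (Fin k) ℝ, X * Y = 1 ∧ Y * X = 1 ∧ Yᵀ = Y := by
    have hdet : IsUnit X.det := (Matrix.isUnit_iff_isUnit_det X).mp hX.isUnit
    exact ⟨X⁻¹, Matrix.mul_nonsing_inv X hdet, Matrix.nonsing_inv_mul X hdet, by
      rw [Matrix.transpose_nonsing_inv, hXt]⟩
  refine ⟨(1 / 2 : ℝ) • (A * Y - Y * Aᵀ), (1 / 2 : ℝ) • (-(Y * Aᵀ) - A * Y), X,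
    (1 / 2 : ℝ) • (Y * Cᵀ + B), (1 / 2 : ℝ) • (Y * Cᵀ - B),
    (1 / 2 : ℝ) • (D + Dᵀ), (1 / 2 : ℝ) • (Dᵀ - D), ?_, ?_, hX, ?_, ?_, ?_, ?_, ?_⟩
  · simp [hYt, ← smul_neg]
  · simp [← smul_neg]
  · have hW := (hKYP.mul_mul_conjTranspose_same
      (fromBlocks Y 0 0 (1 : Matrix (Fin m) (Fin m) ℝ))).smul
      (show (0 : ℝ) ≤ 1 / 2 by norm_num)
    convert hW using 1
    have hYXZ {n : ℕ} (Z : Matrix (Fin k) (Fin n) ℝ) : Y * (X * Z) = Z := by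
      rw [← Matrix.mul_assoc, hYX, Matrix.one_mul]
    simp [fromBlocks_transpose, fromBlocks_multiply, fromBlocks_smul, hYt,
      Matrix.mul_sub, Matrix.sub_mul, Matrix.mul_assoc, hXY, hYXZ]
  · rw [← smul_sub, show A * Y - Y * Aᵀ - (-(Y * Aᵀ) - A * Y) = (2 : ℝ) • (A * Y) by
      rw [two_smul]; abel, smul_smul]
    norm_num [Matrix.mul_assoc, hYX]
  · module
  · rw [← smul_add, show Y * Cᵀ + B + (Y * Cᵀ - B) = (2 : ℝ) • (Y * Cᵀ) by
      rw [two_smul]; abel, smul_smul]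
    norm_num [Matrix.mul_assoc, hYX, hYt]
  · module
end

section
/- Let A ∈ ℝ^{n×n} and let X ∈ ℝ^{n×n} be symmetric positive definite with AᵀX + XA negative semidefinite. Then every purely imaginary eigenvalue λ ∈ iℝ of A (regarded as a complex matrix) is semisimple, i.e., ker((A − λI)²) = ker(A − λI) over ℂⁿ. -/
open Matrix

open scoped ComplexOrder MatrixOrder

/-- The complexification of a real positive semidefinite matrix is positive semidefinite. -/
theorem Matrix.PosSemidef.map_ofReal {ι : Type*} [Fintype ι] {M : Matrix ι ι ℝ}
    (hM : M.PosSemidef) : (M.map Complex.ofReal).PosSemidef := by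
  classical
  obtain ⟨B, rfl⟩ := CStarAlgebra.nonneg_iff_eq_star_mul_self.mp hM.nonneg
  have h : (star B * B).map Complex.ofReal = (B.map Complex.ofReal)ᴴ * B.map Complex.ofReal := by
    ext i j
    simp [Matrix.mul_apply, Matrix.star_apply]
  rw [h]
  exact Matrix.posSemidef_conjTranspose_mul_self _

/-- The complexification of a real positive definite matrix is positive definite. -/
theorem Matrix.PosDef.map_ofReal {ι : Type*} [Fintype ι] {M : Matrix ι ι ℝ}
    (hM : M.PosDef) : (M.map Complex.ofReal).PosDef := by
  classical
  exact hM.posSemidef.map_ofReal.posDef_iff_isUnit.mpr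
    (hM.isUnit.map Complex.ofRealHom.mapMatrix)

/-- If `X` is positive definite and `-(BᴴX + XB)` is positive semidefinite, then `0` is a
semisimple eigenvalue of `B`. -/
theorem Matrix.PosDef.mulVec_eq_zero_of_lyapunov {ι 𝕜 : Type*} [Fintype ι] [RCLike 𝕜]
    {B X : Matrix ι ι 𝕜} (hX : X.PosDef) (hB : (-(Bᴴ * X + X * B)).PosSemidef)
    {v : ι → 𝕜} (hv : B *ᵥ (B *ᵥ v) = 0) : B *ᵥ v = 0 := by
  classical
  set w := B *ᵥ v with hw
  have hQ : (-(Bᴴ * X + X * B)) *ᵥ w = -(Bᴴ *ᵥ (X *ᵥ w)) := by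
    simp [neg_mulVec, add_mulVec, ← mulVec_mulVec, hv]
  have hform : star w ⬝ᵥ ((-(Bᴴ * X + X * B)) *ᵥ w) = 0 := by
    rw [hQ, dotProduct_neg, dotProduct_mulVec, ← star_mulVec, hv]
    simp
  have hXw : Bᴴ *ᵥ (X *ᵥ w) = 0 := by
    rw [← neg_eq_zero, ← hQ]
    exact (hB.dotProduct_mulVec_zero_iff w).mp hform
  have hzero : star w ⬝ᵥ (X *ᵥ w) = 0 := by
    nth_rewrite 1 [hw]
    rw [star_mulVec, ← dotProduct_mulVec, hXw, dotProduct_zero]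
  by_contra hne
  exact (hX.dotProduct_mulVec_pos hne).ne' hzero

/-- Lyapunov inequality lemma for semisimplicity: if `X ≻ 0` is symmetric
and `AᵀX + XA ⪯ 0`, then every purely imaginary eigenvalue `λ` of `A` (as a complex matrix)
is semisimple: `ker((A − λI)²) = ker(A − λI)` over `ℂⁿ`. -/
theorem lyapunov_inequality_imaginary_eigenvalues_semisimple
    (n : ℕ) (A X : Matrix (Fin n) (Fin n) ℝ)
    (hX : X.PosDef)
    (hLyap : (-(Aᵀ * X + X * A)).PosSemidef) :
    ∀ (lam : ℂ), lam.re = 0 →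
      ∀ v : Fin n → ℂ,
        ((A.map Complex.ofReal - lam • 1) * (A.map Complex.ofReal - lam • 1)).mulVec v = 0 ↔
        (A.map Complex.ofReal - lam • 1).mulVec v = 0 := by
  intro lam hlam v
  rw [← mulVec_mulVec]
  refine ⟨fun h => hX.map_ofReal.mulVec_eq_zero_of_lyapunov ?_ h, fun h => by rw [h, mulVec_zero]⟩
  have hstar : star lam = -lam := by
    apply Complex.ext <;> simp [hlam]
  have htrans : (A.map Complex.ofReal)ᴴ = Aᵀ.map Complex.ofReal := by
    ext i j
    simp
  have hmap : (-(Aᵀ * X + X * A)).map Complex.ofReal =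
      -(Aᵀ.map Complex.ofReal * X.map Complex.ofReal
        + X.map Complex.ofReal * A.map Complex.ofReal) := by
    ext i j
    simp [Matrix.mul_apply]
  have hsum : (A.map Complex.ofReal - lam • 1)ᴴ * X.map Complex.ofReal
      + X.map Complex.ofReal * (A.map Complex.ofReal - lam • 1) =
      Aᵀ.map Complex.ofReal * X.map Complex.ofReal
        + X.map Complex.ofReal * A.map Complex.ofReal := by
    rw [conjTranspose_sub, conjTranspose_smul, conjTranspose_one, hstar, htrans,
      sub_mul, mul_sub, smul_mul_assoc, mul_smul_comm, one_mul, mul_one, neg_smul]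
    abel
  have hpos := hLyap.map_ofReal
  rw [hmap, ← hsum] at hpos
  exact hpos
end

section
/- Let A ∈ ℝ^{k×k}, B ∈ ℝ^{k×m}, C ∈ ℝ^{m×k}, D ∈ ℝ^{m×m}, and suppose there exists a symmetric positive definite X ∈ ℝ^{k×k} such that the KYP matrix [[−AᵀX − XA, Cᵀ − XB],[C − BᵀX, D + Dᵀ]] is positive semidefinite. Let K(s) = C(sI − A)⁻¹B + D be the transfer function. Then for every ω ∈ ℝ such that iω is not an eigenvalue of A, the Popov function value Φ(iω) = K(iω)^H + K(iω) (where ^H denotes conjugate transpose, and K(iω)^H = K(−iω)ᵀ since the data are real) is a positive semidefinite Hermitian complex matrix. -/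
open Matrix
open scoped ComplexOrder

open scoped MatrixOrder Matrix.Norms.L2Operator in
/-- A real positive semidefinite matrix stays positive semidefinite over `ℂ`. -/
theorem Matrix.PosSemidef.map_complexOfReal {n : Type*} [Fintype n]
    {M : Matrix n n ℝ} (hM : M.PosSemidef) : (M.map Complex.ofReal).PosSemidef := by
  classical
  obtain ⟨R, rfl⟩ := CStarAlgebra.nonneg_iff_eq_star_mul_self.mp hM.nonneg
  have h : (star R * R).map Complex.ofReal = (R.map Complex.ofReal)ᴴ * R.map Complex.ofReal := by
    ext i j
    simp [Matrix.mul_apply, star_eq_conjTranspose]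
  rw [h]
  exact posSemidef_conjTranspose_mul_self _

/-- If `s` is not an eigenvalue of `A`, then `s • 1 - A` has nonzero determinant. -/
theorem Matrix.det_smul_one_sub_ne_zero {n F : Type*} [Fintype n] [DecidableEq n] [Field F]
    {A : Matrix n n F} {s : F} (h : ¬ ∃ v : n → F, v ≠ 0 ∧ A *ᵥ v = s • v) :
    (s • (1 : Matrix n n F) - A).det ≠ 0 := by
  intro hdet
  obtain ⟨v, hv, hAv⟩ := exists_mulVec_eq_zero_iff.mpr hdet
  refine h ⟨v, hv, ?_⟩
  rw [sub_mulVec, smul_mulVec, one_mulVec, sub_eq_zero] at hAv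
  exact hAv.symm

/-- Congruence of the KYP matrix by `[V; 1]`, where `A V = s V - B` with `s` purely imaginary,
eliminates the certificate `X`. -/
theorem Matrix.conjTranspose_fromRows_mul_kyp_mul {n p : Type*} [Fintype n] [Fintype p]
    [DecidableEq p] (A X : Matrix n n ℂ) (B V : Matrix n p ℂ) (C : Matrix p n ℂ)
    (D : Matrix p p ℂ) {s : ℂ} (hs : star s = -s) (hV : A * V = s • V - B) :
    (fromRows V (1 : Matrix p p ℂ))ᴴ * fromBlocks (-(Aᴴ * X) - X * A) (Cᴴ - X * B) (C - Bᴴ * X) (D + Dᴴ) *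
      fromRows V (1 : Matrix p p ℂ) = (C * V + D)ᴴ + (C * V + D) := by
  have hV' : Vᴴ * Aᴴ = -(s • Vᴴ) - Bᴴ := by
    rw [← conjTranspose_mul, hV, conjTranspose_sub, conjTranspose_smul, hs, neg_smul]
  have hleft : Vᴴ * (Aᴴ * (X * V)) = -(s • (Vᴴ * (X * V))) - Bᴴ * (X * V) := by
    rw [← Matrix.mul_assoc, hV', Matrix.sub_mul, Matrix.neg_mul, Matrix.smul_mul]
  have hright : Vᴴ * (X * (A * V)) = s • (Vᴴ * (X * V)) - Vᴴ * (X * B) := by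
    rw [hV, Matrix.mul_sub, Matrix.mul_sub, Matrix.mul_smul, Matrix.mul_smul]
  rw [conjTranspose_fromRows_eq_fromCols_conjTranspose, fromCols_mul_fromBlocks,
    fromCols_mul_fromRows]
  simp only [conjTranspose_one, Matrix.one_mul, Matrix.mul_one, Matrix.add_mul, Matrix.mul_sub,
    Matrix.sub_mul, Matrix.mul_neg, Matrix.neg_mul, Matrix.mul_assoc, hleft, hright,
    conjTranspose_add, conjTranspose_mul]
  abel

/-- If `(A,B,C,D)` (real data) admits a symmetric positive definite KYP
certificate `X`, then for every `ω ∈ ℝ` such that `iω` is not an eigenvalue of `A`, the Popov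
function value `Φ(iω) = K(iω)ᴴ + K(iω)` of the transfer function
`K(s) = C(sI − A)⁻¹B + D` is a positive semidefinite (Hermitian) complex matrix. -/
theorem KYP_implies_popov_posSemidef_on_imaginary_axis
    (k m : ℕ)
    (A : Matrix (Fin k) (Fin k) ℝ) (B : Matrix (Fin k) (Fin m) ℝ)
    (C : Matrix (Fin m) (Fin k) ℝ) (D : Matrix (Fin m) (Fin m) ℝ)
    (X : Matrix (Fin k) (Fin k) ℝ) (hX : X.PosDef)
    (hKYP : (Matrix.fromBlocks (-(Aᵀ * X) - X * A) (Cᵀ - X * B)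
                               (C - Bᵀ * X) (D + Dᵀ)).PosSemidef)
    (ω : ℝ)
    (hω : ¬ ∃ v : Fin k → ℂ, v ≠ 0 ∧
      (A.map Complex.ofReal).mulVec v = ((Complex.I * ω) • v))
    (K : Matrix (Fin m) (Fin m) ℂ)
    (hK : K = C.map Complex.ofReal *
      ((Complex.I * ω) • (1 : Matrix (Fin k) (Fin k) ℂ) - A.map Complex.ofReal)⁻¹ *
      B.map Complex.ofReal + D.map Complex.ofReal) :
    (Kᴴ + K).PosSemidef := by
  have htranspose : ∀ {p q : ℕ} (M : Matrix (Fin p) (Fin q) ℝ),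
      Mᵀ.map Complex.ofReal = (M.map Complex.ofReal)ᴴ := by
    intro p q M
    ext i j
    simp
  have hmul : ∀ {p q r : ℕ} (M : Matrix (Fin p) (Fin q) ℝ) (N : Matrix (Fin q) (Fin r) ℝ),
      (M * N).map Complex.ofReal = M.map Complex.ofReal * N.map Complex.ofReal :=
    fun M N => Matrix.map_mul (f := Complex.ofRealHom)
  have hadd : ∀ {p q : ℕ} (M N : Matrix (Fin p) (Fin q) ℝ),
      (M + N).map Complex.ofReal = M.map Complex.ofReal + N.map Complex.ofReal :=
    fun M N => Matrix.map_add _ Complex.ofReal_add M N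
  have hsub : ∀ {p q : ℕ} (M N : Matrix (Fin p) (Fin q) ℝ),
      (M - N).map Complex.ofReal = M.map Complex.ofReal - N.map Complex.ofReal :=
    fun M N => Matrix.map_sub _ Complex.ofReal_sub M N
  have hneg : ∀ {p q : ℕ} (M : Matrix (Fin p) (Fin q) ℝ),
      (-M).map Complex.ofReal = -M.map Complex.ofReal := by
    intro p q M
    ext i j
    simp
  have hM := hKYP.map_complexOfReal
  simp only [fromBlocks_map, hsub, hadd, hneg, hmul, htranspose] at hM
  have hdet := det_smul_one_sub_ne_zero hω
  set S := (Complex.I * ω) • (1 : Matrix (Fin k) (Fin k) ℂ) - A.map Complex.ofReal with hS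
  have hV : A.map Complex.ofReal * (S⁻¹ * B.map Complex.ofReal) =
      (Complex.I * ω) • (S⁻¹ * B.map Complex.ofReal) - B.map Complex.ofReal := by
    have hSV : S * (S⁻¹ * B.map Complex.ofReal) = B.map Complex.ofReal :=
      mul_nonsing_inv_cancel_left _ _ hdet.isUnit
    nth_rewrite 1 [hS] at hSV
    rw [Matrix.sub_mul, Matrix.smul_mul, Matrix.one_mul] at hSV
    exact eq_sub_of_add_eq (sub_eq_iff_eq_add'.mp hSV).symm
  have hs : star (Complex.I * (ω : ℂ)) = -(Complex.I * ω) := by simp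
  rw [hK, Matrix.mul_assoc, ← conjTranspose_fromRows_mul_kyp_mul _ (X.map Complex.ofReal) _ _ _ _
    hs hV]
  exact hM.conjTranspose_mul_mul_same _
end

section
/- Let (J,R,Q,G,F,S,N) be pH plant data of state dimension n and port dimension m, and (J_K,R_K,Q_K,G_K,F_K,S_K,N_K) be pH controller data of state dimension k and port dimension m, with Z = [[S−N, I_m],[−I_m, S_K−N_K]] invertible. Then the function s ↦ det L(s), where L(s) is the closed-loop pencil [[sI_n − (J−R)Q, 0, −G+F, 0],[0, sI_k − (J_K−R_K)Q_K, 0, −G_K+F_K],[(G+F)ᵀQ, 0, S−N, I_m],[0, (G_K+F_K)ᵀQ_K, −I_m, S_K−N_K]], is a polynomial in s of degree exactly n + k with leading coefficient det(Z) ≠ 0; in particular the pencil is regular and has exactly n + k finite eigenvalues counted with multiplicity (the remaining 2m eigenvalues being at infinity). -/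
open Matrix

/-- The determinant of a bordered characteristic pencil with invertible corner `D` is, up to the
factor `det D`, the characteristic polynomial of the Schur complement. -/
theorem det_fromBlocks_smul_one_sub {ι κ K : Type*} [Fintype ι] [DecidableEq ι] [Fintype κ]
    [DecidableEq κ] [CommRing K] (A : Matrix ι ι K) (B : Matrix ι κ K) (C : Matrix κ ι K)
    (D : Matrix κ κ K) (hD : IsUnit D.det) (s : K) :
    (Matrix.fromBlocks (s • 1 - A) B C D).det =
      D.det * (A + B * D⁻¹ * C).charpoly.eval s := by
  have := D.invertibleOfIsUnitDet hD
  rw [Matrix.det_fromBlocks₂₂, Matrix.eval_charpoly, Matrix.invOf_eq_nonsing_inv,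
    Matrix.scalar_apply, ← Matrix.smul_one_eq_diagonal, sub_sub]

/-- For pH plant and controller data with `Z = [[S−N, I],[−I, SK−NK]]`
invertible, `s ↦ det L(s)` (with `L` the closed-loop pencil) is a polynomial in `s` of degree
exactly `n + k` with leading coefficient `det Z ≠ 0`; in particular the pencil is regular and
has exactly `n + k` finite eigenvalues counted with multiplicity. -/
theorem pencil_det_polynomial_degree_leadingCoeff
    (n k m : ℕ)
    (J R Q : Matrix (Fin n) (Fin n) ℝ) (G F : Matrix (Fin n) (Fin m) ℝ)
    (S N : Matrix (Fin m) (Fin m) ℝ)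
    (JK RK QK : Matrix (Fin k) (Fin k) ℝ) (GK FK : Matrix (Fin k) (Fin m) ℝ)
    (SK NK : Matrix (Fin m) (Fin m) ℝ)
    (hJ : Jᵀ = -J) (hN : Nᵀ = -N) (hQ : Q.PosDef)
    (hW : (Matrix.fromBlocks R F Fᵀ S).PosSemidef)
    (hJK : JKᵀ = -JK) (hNK : NKᵀ = -NK) (hQK : QK.PosDef)
    (hWK : (Matrix.fromBlocks RK FK FKᵀ SK).PosSemidef)
    (Z : Matrix (Fin m ⊕ Fin m) (Fin m ⊕ Fin m) ℝ)
    (hZ : Z = Matrix.fromBlocks (S - N) 1 (-1) (SK - NK))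
    (hZinv : IsUnit Z.det)
    (L : ℂ → Matrix ((Fin n ⊕ Fin k) ⊕ (Fin m ⊕ Fin m))
                    ((Fin n ⊕ Fin k) ⊕ (Fin m ⊕ Fin m)) ℂ)
    (hL : ∀ s : ℂ, L s = Matrix.fromBlocks
      (Matrix.fromBlocks (s • 1 - ((J - R) * Q).map Complex.ofReal) 0
                         0 (s • 1 - ((JK - RK) * QK).map Complex.ofReal))
      (Matrix.fromBlocks ((-G + F).map Complex.ofReal) 0
                         0 ((-GK + FK).map Complex.ofReal))
      (Matrix.fromBlocks (((G + F)ᵀ * Q).map Complex.ofReal) 0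
                         0 (((GK + FK)ᵀ * QK).map Complex.ofReal))
      (Matrix.fromBlocks ((S - N).map Complex.ofReal) 1
                         (-1) ((SK - NK).map Complex.ofReal))) :
    ∃ p : Polynomial ℂ,
      (∀ s : ℂ, p.eval s = (L s).det) ∧
      p.degree = (n + k : ℕ) ∧
      p.leadingCoeff = (Z.det : ℂ) ∧ (Z.det : ℂ) ≠ 0 := by
  have hZ0 : (Z.det : ℂ) ≠ 0 := Complex.ofReal_ne_zero.mpr hZinv.ne_zero
  set D : Matrix (Fin m ⊕ Fin m) (Fin m ⊕ Fin m) ℂ :=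
    Matrix.fromBlocks ((S - N).map Complex.ofReal) 1 (-1) ((SK - NK).map Complex.ofReal)
  have hDZ : D = Z.map Complex.ofRealHom := by
    rw [hZ, Matrix.fromBlocks_map, Matrix.map_one _ (map_zero _) (map_one _),
      Matrix.map_neg _ (map_neg _), Matrix.map_one _ (map_zero _) (map_one _)]
    rfl
  have hD : D.det = (Z.det : ℂ) := by
    rw [hDZ]
    exact (RingHom.map_det Complex.ofRealHom Z).symm
  set A := Matrix.fromBlocks (((J - R) * Q).map Complex.ofReal) 0
    0 (((JK - RK) * QK).map Complex.ofReal)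
  set B := Matrix.fromBlocks ((-G + F).map Complex.ofReal) 0
    0 ((-GK + FK).map Complex.ofReal)
  set C := Matrix.fromBlocks (((G + F)ᵀ * Q).map Complex.ofReal) 0
    0 (((GK + FK)ᵀ * QK).map Complex.ofReal)
  have hM := (A + B * D⁻¹ * C).charpoly_monic
  refine ⟨Polynomial.C (Z.det : ℂ) * (A + B * D⁻¹ * C).charpoly, fun s => ?_, ?_, ?_, hZ0⟩
  · have hA : Matrix.fromBlocks (s • 1 - ((J - R) * Q).map Complex.ofReal) 0
        0 (s • 1 - ((JK - RK) * QK).map Complex.ofReal) = s • 1 - A := by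
      rw [← Matrix.fromBlocks_one, Matrix.fromBlocks_smul, sub_eq_add_neg _ A, Matrix.fromBlocks_neg,
        Matrix.fromBlocks_add]
      simp [sub_eq_add_neg]
    rw [hL, hA, det_fromBlocks_smul_one_sub _ _ _ _ (by rw [hD]; exact hZ0.isUnit), hD]
    simp
  · rw [Polynomial.degree_C_mul hZ0, Matrix.charpoly_degree_eq_dim]
    simp
  · rw [Polynomial.leadingCoeff_mul, hM.leadingCoeff, Polynomial.leadingCoeff_C, mul_one]
end
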